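/- Let F ∈ 𝒜* with ∫_ℝ F(x) dx = 1 and suppose the essential supremum of |𝓗(F)| over ℝ equals 1. Then F(x) = (2/π)·log((1 + √(1 − 4x²))/(2|x|)) for almost every x ∈ [−1/2, 1/2]; that is, the extremal function for the extremal problem (EP2) is unique up to multiplication by a positive constant, and is given by 𝔉. -/

import Mathlib

open MeasureTheory Filter

/-- The principal-value Hilbert transform of `F` at `x` exists and equals `L`:
`𝓗(F)(x) = lim_{ε→0⁺} (1/π)·∫_{|t|≥ε} F(x−t)/t dt`. -/
def pvHilbAt (F : ℝ → ℝ) (x L : ℝ) : Prop :=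
  Tendsto (fun ε : ℝ => (1 / Real.pi) * ∫ t in {t : ℝ | ε ≤ |t|}, F (x - t) / t)
    (nhdsWithin 0 (Set.Ioi 0)) (nhds L)

/-- The class `𝒜*`: `F ∈ L¹(ℝ)`, `F ≥ 0` a.e., support contained in `[-1/2,1/2]`. -/
def memAstar (F : ℝ → ℝ) : Prop :=
  Integrable F ∧ (∀ᵐ x ∂(volume : Measure ℝ), 0 ≤ F x) ∧
    ∀ᵐ x ∂(volume : Measure ℝ), x ∉ Set.Icc (-(1/2) : ℝ) (1/2) → F x = 0


lemma ker_le (η : ℝ) (hη : 0 < η) (t : ℝ) :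
    ENNReal.ofReal (η / (t ^ 2 + η ^ 2)) ≤
      ∑' k : ℕ, Set.indicator {t : ℝ | |t| ≤ 2 ^ k * η}
        (fun _ => ENNReal.ofReal (4 * (1 / 4) ^ k / η)) t := by
  have hex : ∃ k : ℕ, |t| ≤ 2 ^ k * η := by
    obtain ⟨k, hk⟩ := pow_unbounded_of_one_lt (|t| / η) (one_lt_two)
    exact ⟨k, by rw [div_lt_iff₀ hη] at hk; exact hk.le⟩
  classical
  obtain ⟨k, hk, hmin⟩ : ∃ k : ℕ, |t| ≤ 2 ^ k * η ∧ ∀ m < k, ¬ |t| ≤ 2 ^ m * η :=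
    ⟨Nat.find hex, Nat.find_spec hex, fun m hm => Nat.find_min hex hm⟩
  refine le_trans ?_ (ENNReal.le_tsum k)
  rw [Set.indicator_of_mem (by exact hk)]
  apply ENNReal.ofReal_le_ofReal
  have hpos : 0 < t ^ 2 + η ^ 2 := by positivity
  rw [div_le_div_iff₀ hpos hη]
  rcases k with _ | k
  · simp; nlinarith [sq_nonneg t]
  · have h1 := hmin k (Nat.lt_succ_self k)
    push Not at h1
    have h2 : (2 ^ k * η) ^ 2 ≤ t ^ 2 := by
      rw [← sq_abs t]; exact pow_le_pow_left₀ (by positivity) h1.le 2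
    have h3 : ((1:ℝ) / 4) ^ k * (2 ^ k) ^ 2 = 1 := by
      rw [← pow_mul, mul_comm k 2, pow_mul, ← mul_pow]; norm_num
    have h4 : (0:ℝ) ≤ (1 / 4) ^ k := by positivity
    calc η * η = ((1:ℝ) / 4) ^ k * (2 ^ k) ^ 2 * η ^ 2 := by rw [h3]; ring
      _ = (1 / 4) ^ k * (2 ^ k * η) ^ 2 := by ring
      _ ≤ (1 / 4) ^ k * t ^ 2 := by gcongr
      _ ≤ 4 * (1 / 4) ^ (k + 1) * (t ^ 2 + η ^ 2) := by
        rw [pow_succ (1 / 4 : ℝ) k]; nlinarith [mul_nonneg h4 (sq_nonneg η)]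

lemma leb_point (F : ℝ → ℝ) (hF : Integrable F) : ∀ᵐ x ∂(volume : Measure ℝ),
    Tendsto (fun η : ℝ => ∫⁻ t, ‖F (x - t) - F x‖ₑ * ENNReal.ofReal (η / (t ^ 2 + η ^ 2)))
      (nhdsWithin 0 (Set.Ioi 0)) (nhds 0) := by
  filter_upwards [(Besicovitch.vitaliFamily (volume : Measure ℝ)).ae_tendsto_lintegral_enorm_sub_div
    hF.locallyIntegrable] with x hx
  replace hx := hx.comp (Besicovitch.tendsto_filterAt volume x)
  set q : ℝ → ENNReal := fun r => (∫⁻ y in Metric.closedBall x r, ‖F y - F x‖ₑ) /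
    volume (Metric.closedBall x r) with hq
  have hx : Tendsto q (nhdsWithin 0 (Set.Ioi 0)) (nhds 0) := hx
  have hFfin : ∫⁻ y, ‖F y‖ₑ < ⊤ := hF.2
  have hvol : ∀ r : ℝ, volume (Metric.closedBall x r) = ENNReal.ofReal (2 * r) :=
    fun r => Real.volume_closedBall x r
  have hqb : ∃ C : ENNReal, C ≠ ⊤ ∧ ∀ r > 0, q r ≤ C := by
    have h1 : ∀ᶠ r in nhdsWithin (0:ℝ) (Set.Ioi 0), q r < 1 :=
      hx.eventually (gt_mem_nhds one_pos)
    obtain ⟨δ, hδ, h2⟩ := mem_nhdsGT_iff_exists_Ioo_subset.1 h1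
    have hδ : 0 < δ := hδ
    refine ⟨1 + ((∫⁻ y, ‖F y‖ₑ) / ENNReal.ofReal (2 * δ) + ‖F x‖ₑ), ?_, ?_⟩
    · have : (∫⁻ y, ‖F y‖ₑ) / ENNReal.ofReal (2 * δ) ≠ ⊤ :=
        ENNReal.div_ne_top hFfin.ne (by simp [hδ])
      exact ENNReal.add_ne_top.2 ⟨ENNReal.one_ne_top, ENNReal.add_ne_top.2 ⟨this, enorm_ne_top⟩⟩
    · intro r hr
      by_cases hrδ : r < δ
      · exact (le_of_lt (h2 ⟨hr, hrδ⟩)).trans le_self_add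
      push Not at hrδ
      refine le_trans ?_ le_add_self
      have h3 : ∫⁻ y in Metric.closedBall x r, ‖F y - F x‖ₑ ≤
          (∫⁻ y, ‖F y‖ₑ) + ‖F x‖ₑ * ENNReal.ofReal (2 * r) := by
        calc ∫⁻ y in Metric.closedBall x r, ‖F y - F x‖ₑ
            ≤ ∫⁻ y in Metric.closedBall x r, (‖F y‖ₑ + ‖F x‖ₑ) :=
              lintegral_mono fun y => enorm_sub_le
          _ = (∫⁻ y in Metric.closedBall x r, ‖F y‖ₑ) + ‖F x‖ₑ * ENNReal.ofReal (2 * r) := by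
              rw [lintegral_add_right _ measurable_const, setLIntegral_const, hvol]
          _ ≤ _ := by gcongr; exact Measure.restrict_le_self
      have hr0 : ENNReal.ofReal (2 * r) ≠ 0 := by simp [hr]
      calc q r ≤ ((∫⁻ y, ‖F y‖ₑ) + ‖F x‖ₑ * ENNReal.ofReal (2 * r)) / ENNReal.ofReal (2 * r) := by
            simp only [hq, hvol]; gcongr
        _ = (∫⁻ y, ‖F y‖ₑ) / ENNReal.ofReal (2 * r) + ‖F x‖ₑ := by
            rw [ENNReal.add_div, ENNReal.mul_div_cancel_right hr0 ENNReal.ofReal_ne_top]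
        _ ≤ _ := by gcongr
  obtain ⟨C, hC, hqC⟩ := hqb
  have hdom : Tendsto (fun η : ℝ => ∑' k : ℕ, ENNReal.ofReal (8 * (1 / 2) ^ k) * q (2 ^ k * η))
      (nhdsWithin 0 (Set.Ioi 0)) (nhds 0) := by
    have h0 : ∑' k : ℕ, (0 : ENNReal) = 0 := by simp
    rw [← h0]
    simp_rw [← lintegral_count]
    apply tendsto_lintegral_filter_of_dominated_convergence
      (fun k : ℕ => ENNReal.ofReal (8 * (1 / 2) ^ k) * C)
    · exact Eventually.of_forall fun η => measurable_from_top
    · filter_upwards [self_mem_nhdsWithin] with η hη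
      have hη : 0 < η := hη
      refine Eventually.of_forall fun k => ?_
      gcongr
      exact hqC _ (by positivity)
    · rw [lintegral_count, ENNReal.tsum_mul_right]
      refine ENNReal.mul_ne_top ?_ hC
      rw [← ENNReal.ofReal_tsum_of_nonneg (fun k => by positivity)
        (summable_geometric_two.mul_left 8)]
      exact ENNReal.ofReal_ne_top
    · refine Eventually.of_forall fun k => ?_
      have h1 : Tendsto (fun η : ℝ => 2 ^ k * η) (nhdsWithin 0 (Set.Ioi 0))
          (nhdsWithin 0 (Set.Ioi 0)) := by
        apply tendsto_nhdsWithin_iff.2 ⟨?_, ?_⟩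
        · have : Tendsto (fun η : ℝ => 2 ^ k * η) (nhds 0) (nhds (2 ^ k * 0)) :=
            (continuous_const.mul continuous_id).tendsto 0
          rw [mul_zero] at this
          exact this.mono_left nhdsWithin_le_nhds
        · filter_upwards [self_mem_nhdsWithin] with η hη
          have hη : 0 < η := hη
          exact Set.mem_Ioi.2 (by positivity)
      have := ENNReal.Tendsto.const_mul (a := ENNReal.ofReal (8 * (1 / 2) ^ k)) (hx.comp h1)
        (Or.inr ENNReal.ofReal_ne_top)
      simpa using this
  refine tendsto_of_tendsto_of_tendsto_of_le_of_le' tendsto_const_nhds hdom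
    (Eventually.of_forall fun _ => zero_le) ?_
  filter_upwards [self_mem_nhdsWithin] with η hη
  have hη : 0 < η := hη
  calc ∫⁻ t, ‖F (x - t) - F x‖ₑ * ENNReal.ofReal (η / (t ^ 2 + η ^ 2))
      = ∫⁻ t, ‖F t - F x‖ₑ * ENNReal.ofReal (η / ((x - t) ^ 2 + η ^ 2)) := by
        rw [← lintegral_sub_left_eq_self _ x]; simp
    _ ≤ ∫⁻ t, ∑' k : ℕ, Set.indicator (Metric.closedBall x (2 ^ k * η)) (fun t =>
          ENNReal.ofReal (4 * (1 / 4) ^ k / η) * ‖F t - F x‖ₑ) t := by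
        apply lintegral_mono fun t => ?_
        refine (mul_le_mul_right (ker_le η hη (x - t)) _).trans (le_of_eq ?_)
        rw [← ENNReal.tsum_mul_left]
        congr 1; ext k
        by_cases h : t ∈ Metric.closedBall x (2 ^ k * η)
        · rw [Set.indicator_of_mem h, Set.indicator_of_mem, mul_comm]
          rw [Metric.mem_closedBall, dist_comm, Real.dist_eq] at h; exact h
        · rw [Set.indicator_of_notMem h, Set.indicator_of_notMem, mul_zero]
          rw [Metric.mem_closedBall, dist_comm, Real.dist_eq] at h; exact h
    _ = ∑' k : ℕ, ENNReal.ofReal (4 * (1 / 4) ^ k / η) *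
          ∫⁻ t in Metric.closedBall x (2 ^ k * η), ‖F t - F x‖ₑ := by
        have hm : AEMeasurable (fun t => ‖F t - F x‖ₑ) :=
          (hF.1.sub aestronglyMeasurable_const).enorm
        rw [lintegral_tsum]
        · congr 1; ext k
          rw [lintegral_indicator measurableSet_closedBall, lintegral_const_mul' _ _ ENNReal.ofReal_ne_top]
        · intro k
          exact (hm.const_mul _).indicator measurableSet_closedBall
    _ ≤ _ := by
        apply ENNReal.tsum_le_tsum fun k => ?_
        have hr : 0 < 2 ^ k * η := by positivity
        have h2 : ∫⁻ t in Metric.closedBall x (2 ^ k * η), ‖F t - F x‖ₑ =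
            q (2 ^ k * η) * ENNReal.ofReal (2 * (2 ^ k * η)) := by
          simp only [hq, hvol]
          rw [ENNReal.div_mul_cancel (by simp [hη]) ENNReal.ofReal_ne_top]
        rw [h2, mul_comm (q _), ← mul_assoc, ← ENNReal.ofReal_mul (by positivity)]
        apply le_of_eq
        congr 2
        have h3 : ((1:ℝ) / 4) ^ k * 2 ^ k = (1 / 2) ^ k := by rw [← mul_pow]; norm_num
        rw [← h3]
        field_simp
        ring


/-- difference kernel -/
noncomputable def dker (η t : ℝ) : ℂ :=
  1 / ((t : ℂ) + η * Complex.I) - Set.indicator {t : ℝ | η ≤ |t|} (fun t => 1 / (t : ℂ)) t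

lemma dker_eq (η t : ℝ) (hη : 0 < η) : dker η t =
    ((t / (t ^ 2 + η ^ 2) - Set.indicator {t : ℝ | η ≤ |t|} (fun t => 1 / t) t : ℝ) : ℂ)
      - ((η / (t ^ 2 + η ^ 2) : ℝ) : ℂ) * Complex.I := by
  have h1 : (t : ℂ) ^ 2 + η ^ 2 ≠ 0 := by
    have : t ^ 2 + η ^ 2 ≠ 0 := by positivity
    exact_mod_cast this
  have h2 : (t : ℂ) + η * Complex.I ≠ 0 := by
    intro h
    have := congrArg Complex.im h
    simp at this; exact hη.ne' this
  have h3 : 1 / ((t : ℂ) + η * Complex.I) = (t - η * Complex.I) / (t ^ 2 + η ^ 2) := by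
    rw [div_eq_div_iff h2 h1]
    linear_combination ((η : ℂ) ^ 2) * Complex.I_sq
  unfold dker
  rw [h3]
  by_cases h : t ∈ {t : ℝ | η ≤ |t|}
  · rw [Set.indicator_of_mem h, Set.indicator_of_mem h]; push_cast; ring
  · rw [Set.indicator_of_notMem h, Set.indicator_of_notMem h]; push_cast; ring

lemma odd_bound (η t : ℝ) (hη : 0 < η) :
    |t / (t ^ 2 + η ^ 2) - Set.indicator {t : ℝ | η ≤ |t|} (fun t => 1 / t) t| ≤
      η / (t ^ 2 + η ^ 2) := by
  have hp : 0 < t ^ 2 + η ^ 2 := by positivity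
  by_cases h : t ∈ {t : ℝ | η ≤ |t|}
  · rw [Set.indicator_of_mem h]
    have h : η ≤ |t| := h
    have ht : t ≠ 0 := by rintro rfl; simp at h; linarith
    have : t / (t ^ 2 + η ^ 2) - 1 / t = -(η ^ 2 / (t * (t ^ 2 + η ^ 2))) := by
      field_simp; ring
    rw [this, abs_neg, abs_div, abs_mul, abs_of_pos hp, abs_of_pos (by positivity : 0 < η ^ 2),
      div_le_div_iff₀ (by positivity) hp]
    nlinarith [mul_le_mul_of_nonneg_left h (mul_pos hη hp).le]
  · rw [Set.indicator_of_notMem h]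
    have h : ¬ η ≤ |t| := h
    push Not at h
    rw [sub_zero, abs_div, abs_of_pos hp]
    gcongr

lemma dker_norm (η t : ℝ) (hη : 0 < η) : ‖dker η t‖ ≤ 2 * (η / (t ^ 2 + η ^ 2)) := by
  rw [dker_eq η t hη]
  refine (norm_sub_le _ _).trans ?_
  rw [norm_mul, Complex.norm_I, Complex.norm_real, Complex.norm_real, mul_one, Real.norm_eq_abs,
    Real.norm_eq_abs, abs_of_pos (by positivity : 0 < η / (t ^ 2 + η ^ 2))]
  linarith [odd_bound η t hη]

lemma poisson_int (η : ℝ) (hη : 0 < η) : Integrable (fun t : ℝ => η / (t ^ 2 + η ^ 2)) ∧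
    ∫ t : ℝ, η / (t ^ 2 + η ^ 2) = Real.pi := by
  have h : (fun t : ℝ => η / (t ^ 2 + η ^ 2)) = fun t => η⁻¹ * (1 + (t / η) ^ 2)⁻¹ := by
    ext t; field_simp; ring
  rw [h]
  refine ⟨(integrable_inv_one_add_sq.comp_div hη.ne').const_mul _, ?_⟩
  rw [integral_const_mul, Measure.integral_comp_div (fun t : ℝ => (1 + t ^ 2)⁻¹),
    integral_univ_inv_one_add_sq, abs_of_pos hη, smul_eq_mul]
  field_simp

lemma dker_meas (η : ℝ) : Measurable (dker η) := by
  unfold dker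
  refine Measurable.sub (by fun_prop) (Measurable.indicator (by fun_prop) ?_)
  exact measurableSet_le measurable_const (by fun_prop)

lemma dker_int (η : ℝ) (hη : 0 < η) : Integrable (dker η) ∧
    ∫ t : ℝ, dker η t = - (Real.pi : ℂ) * Complex.I := by
  have hi : Integrable (dker η) := ((poisson_int η hη).1.const_mul 2).mono'
    (dker_meas η).aestronglyMeasurable (Eventually.of_forall fun t => dker_norm η t hη)
  refine ⟨hi, ?_⟩
  set o : ℝ → ℝ := fun t => t / (t ^ 2 + η ^ 2) - Set.indicator {t : ℝ | η ≤ |t|} (fun t => 1 / t) t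
    with ho
  have hom : Measurable o := by
    refine Measurable.sub (by fun_prop) (Measurable.indicator (by fun_prop) ?_)
    exact measurableSet_le measurable_const (by fun_prop)
  have hoi : Integrable o := (poisson_int η hη).1.mono' hom.aestronglyMeasurable
    (Eventually.of_forall fun t => odd_bound η t hη)
  have hodd : ∀ t, o (-t) = - o t := by
    intro t
    simp only [ho]
    by_cases h : t ∈ {t : ℝ | η ≤ |t|}
    · have h' : -t ∈ {t : ℝ | η ≤ |t|} := by simpa using h
      rw [Set.indicator_of_mem h, Set.indicator_of_mem h', neg_sq, neg_div, one_div_neg_eq_neg_one_div]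
      ring
    · have h' : -t ∉ {t : ℝ | η ≤ |t|} := by simpa using h
      rw [Set.indicator_of_notMem h, Set.indicator_of_notMem h', neg_sq, neg_div]
      ring
  have ho0 : ∫ t, o t = 0 := by
    have h1 := integral_neg_eq_self o volume
    simp_rw [hodd, integral_neg] at h1
    linarith
  have h2 : ∀ t, dker η t = (o t : ℂ) - ((η / (t ^ 2 + η ^ 2) : ℝ) : ℂ) * Complex.I :=
    fun t => dker_eq η t hη
  simp_rw [h2]
  rw [integral_sub hoi.ofReal ((poisson_int η hη).1.ofReal.mul_const _), integral_mul_const,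
    integral_complex_ofReal, integral_complex_ofReal, ho0, (poisson_int η hη).2]
  simp

/-- Cauchy transform. -/
noncomputable def cau (F : ℝ → ℝ) (z : ℂ) : ℂ := ∫ s : ℝ, (F s : ℂ) * (1 / (z - s))

lemma cau_integrable (F : ℝ → ℝ) (hF : Integrable F) (z : ℂ) (hz : 0 < z.im) :
    Integrable (fun s : ℝ => (F s : ℂ) * (1 / (z - s))) := by
  refine hF.ofReal.mul_bdd (c := 1 / z.im) ?_ (Eventually.of_forall fun s => ?_)
  · exact (by fun_prop : Measurable fun s : ℝ => 1 / (z - (s : ℂ))).aestronglyMeasurable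
  · rw [norm_div, norm_one]
    apply one_div_le_one_div_of_le hz
    have := Complex.abs_im_le_norm (z - s)
    simp at this
    exact (le_abs_self _).trans this

lemma bdry (F : ℝ → ℝ) (hF : Integrable F) : ∀ᵐ x ∂(volume : Measure ℝ), ∀ L : ℝ,
    pvHilbAt F x L → Tendsto (fun η : ℝ => cau F (x + η * Complex.I))
      (nhdsWithin 0 (Set.Ioi 0)) (nhds ((Real.pi * L : ℝ) - (Real.pi * F x : ℝ) * Complex.I)) := by
  filter_upwards [leb_point F hF] with x hx L hL
  set H : ℝ → ℝ := fun ε => ∫ t in {t : ℝ | ε ≤ |t|}, F (x - t) / t with hH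
  have hL1 : Tendsto H (nhdsWithin 0 (Set.Ioi 0)) (nhds (Real.pi * L)) := by
    have := hL.const_mul Real.pi
    refine this.congr fun ε => ?_
    simp only [hH]; field_simp
  have hL2 : Tendsto (fun ε => (H ε : ℂ) - (Real.pi * F x : ℝ) * Complex.I)
      (nhdsWithin 0 (Set.Ioi 0)) (nhds ((Real.pi * L : ℝ) - (Real.pi * F x : ℝ) * Complex.I)) :=
    ((Complex.continuous_ofReal.tendsto _).comp hL1).sub_const _
  suffices h : Tendsto (fun η : ℝ => cau F (x + η * Complex.I) -
      ((H η : ℂ) - (Real.pi * F x : ℝ) * Complex.I)) (nhdsWithin 0 (Set.Ioi 0)) (nhds 0) by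
    simpa using h.add hL2
  have hx1 := ENNReal.Tendsto.const_mul (a := 2) hx (Or.inr (by simp))
  rw [mul_zero] at hx1
  have hx2 := (ENNReal.tendsto_toReal ENNReal.zero_ne_top).comp hx1
  rw [ENNReal.toReal_zero] at hx2
  have hfin : ∀ᶠ η in nhdsWithin (0:ℝ) (Set.Ioi 0),
    ∫⁻ t, ‖F (x - t) - F x‖ₑ * ENNReal.ofReal (η / (t ^ 2 + η ^ 2)) < 1 :=
      hx.eventually (gt_mem_nhds one_pos)
  refine squeeze_zero_norm' ?_ hx2
  filter_upwards [self_mem_nhdsWithin, hfin] with η hη hfin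
  have hη : 0 < η := hη
  have hS : MeasurableSet {t : ℝ | η ≤ |t|} := measurableSet_le measurable_const (by fun_prop)
  have hFx : Integrable (fun t => F (x - t)) := hF.comp_sub_left x
  have e1 : cau F (x + η * Complex.I) =
      ∫ t : ℝ, (F (x - t) : ℂ) * (1 / ((t : ℂ) + η * Complex.I)) := by
    unfold cau
    rw [← integral_sub_left_eq_self _ _ x]
    congr 1; ext t; push_cast; congr 2; ring
  have i1 : Integrable fun t : ℝ => (F (x - t) : ℂ) * (1 / ((t : ℂ) + η * Complex.I)) := by
    have := (cau_integrable F hF (x + η * Complex.I) (by simpa using hη)).comp_sub_left x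
    refine this.congr (Eventually.of_forall fun t => ?_)
    simp only; push_cast; congr 2; ring
  have e2 : (H η : ℂ) = ∫ t : ℝ, (F (x - t) : ℂ) *
      Set.indicator {t : ℝ | η ≤ |t|} (fun t => 1 / (t : ℂ)) t := by
    simp only [hH]
    rw [← integral_indicator hS, ← integral_complex_ofReal]
    congr 1; ext t
    by_cases h : t ∈ {t : ℝ | η ≤ |t|}
    · rw [Set.indicator_of_mem h, Set.indicator_of_mem h]; push_cast; ring
    · rw [Set.indicator_of_notMem h, Set.indicator_of_notMem h]; simp
  have i2 : Integrable fun t : ℝ => (F (x - t) : ℂ) *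
      Set.indicator {t : ℝ | η ≤ |t|} (fun t => 1 / (t : ℂ)) t := by
    refine hFx.ofReal.mul_bdd (c := 1 / η) ?_ (Eventually.of_forall fun t => ?_)
    · exact (Measurable.indicator (by fun_prop) hS).aestronglyMeasurable
    · by_cases h : t ∈ {t : ℝ | η ≤ |t|}
      · rw [Set.indicator_of_mem h, norm_div, norm_one, Complex.norm_real]
        exact one_div_le_one_div_of_le hη h
      · rw [Set.indicator_of_notMem h]; simp; exact hη.le
  have hd := dker_int η hη
  have e3 : cau F (x + η * Complex.I) - ((H η : ℂ) - (Real.pi * F x : ℝ) * Complex.I) =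
      ∫ t : ℝ, ((F (x - t) - F x : ℝ) : ℂ) * dker η t := by
    have : ∀ t : ℝ, ((F (x - t) - F x : ℝ) : ℂ) * dker η t =
        ((F (x - t) : ℂ) * (1 / ((t : ℂ) + η * Complex.I)) - (F (x - t) : ℂ) *
      Set.indicator {t : ℝ | η ≤ |t|} (fun t => 1 / (t : ℂ)) t) - (F x : ℂ) * dker η t := by
      intro t; push_cast; unfold dker; ring
    have i3 : Integrable fun t : ℝ => (F (x - t) : ℂ) * (1 / ((t : ℂ) + η * Complex.I)) -
        (F (x - t) : ℂ) * Set.indicator {t : ℝ | η ≤ |t|} (fun t => 1 / (t : ℂ)) t := i1.sub i2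
    simp_rw [this]
    rw [integral_sub i3 (hd.1.const_mul _), integral_sub i1 i2, integral_const_mul, hd.2,
      ← e1, ← e2]
    push_cast; ring
  rw [e3]
  refine (norm_integral_le_lintegral_norm _).trans ?_
  simp only [Function.comp]
  apply ENNReal.toReal_mono
  · exact ENNReal.mul_ne_top (by simp) (hfin.trans ENNReal.one_lt_top).ne
  · rw [← lintegral_const_mul' _ _ (by simp)]
    apply lintegral_mono fun t => ?_
    rw [norm_mul, ENNReal.ofReal_mul (norm_nonneg _), Complex.norm_real, ofReal_norm]
    rw [mul_left_comm]
    gcongr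
    refine (ENNReal.ofReal_le_ofReal (dker_norm η t hη)).trans ?_
    rw [ENNReal.ofReal_mul (by norm_num)]; simp


lemma mean_line (f : ℂ → ℂ) (hf : DifferentiableOn ℂ f {z | 0 < z.im})
    (hb : ∀ z : ℂ, 0 < z.im → ‖f z‖ ≤ 1) (x0 y0 η : ℝ) (hy : 0 < y0) (hη : 0 < η) :
    f (x0 + ((y0 + η : ℝ) : ℂ) * Complex.I) = (2 * Real.pi)⁻¹ • ∫ θ in (0:ℝ)..2 * Real.pi,
      f ((x0 + y0 * (Real.sin (θ / 2) / Real.cos (θ / 2)) : ℝ) + η * Complex.I) := by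
  set c : ℂ → ℂ := fun s => x0 + η * Complex.I + Complex.I * y0 * ((1 - s) / (1 + s)) with hc
  have him : ∀ s : ℂ, ‖s‖ ≤ 1 → 0 < (c s).im := by
    intro s hs
    have h1 : (c s).im = η + y0 * ((1 - s) / (1 + s)).re := by
      simp [hc, mul_assoc]
    have h2 : 0 ≤ ((1 - s) / (1 + s)).re := by
      rw [Complex.div_re, ← add_div]
      apply div_nonneg _ (Complex.normSq_nonneg _)
      have h3 : s.re * s.re + s.im * s.im ≤ 1 := by
        rw [← Complex.normSq_apply, Complex.normSq_eq_norm_sq]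
        nlinarith [norm_nonneg s]
      simp
      nlinarith
    rw [h1]
    positivity
  have hne : ∀ s : ℂ, ‖s‖ < 1 → 1 + s ≠ 0 := by
    intro s hs h
    have : s = -1 := by linear_combination h
    rw [this] at hs; simp at hs
  have hcd : ∀ s : ℂ, 1 + s ≠ 0 → DifferentiableAt ℂ c s := by
    intro s hs
    simp only [hc]
    fun_prop (disch := exact hs)
  have hopen : IsOpen {z : ℂ | 0 < z.im} := isOpen_lt continuous_const Complex.continuous_im
  have hgd : ∀ s : ℂ, ‖s‖ ≤ 1 → 1 + s ≠ 0 → DifferentiableAt ℂ (f ∘ c) s := fun s h1 h2 =>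
    ((hf.differentiableAt (hopen.mem_nhds (him s h1))).comp s (hcd s h2))
  have hmv : ∀ r ∈ Set.Ioo (0:ℝ) 1, (2 * Real.pi)⁻¹ • ∫ θ in (0:ℝ)..2 * Real.pi,
      f (c (circleMap 0 r θ)) = f (c 0) := by
    intro r hr
    have h1 : DifferentiableOn ℂ (f ∘ c) (Metric.ball 0 1) := fun s hs => by
      have hs : ‖s‖ < 1 := by simpa using hs
      exact (hgd s hs.le (hne s hs)).differentiableWithinAt
    have h2 : DiffContOnCl ℂ (f ∘ c) (Metric.ball 0 |r|) := by
      apply h1.diffContOnCl_ball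
      apply Metric.closedBall_subset_ball
      rw [abs_of_pos hr.1]; exact hr.2
    have := h2.circleAverage
    rw [Real.circleAverage_def] at this
    exact this
  have hlim : Tendsto (fun r : ℝ => (2 * Real.pi)⁻¹ • ∫ θ in (0:ℝ)..2 * Real.pi,
      f (c (circleMap 0 r θ))) (nhdsWithin 1 (Set.Iio 1))
      (nhds ((2 * Real.pi)⁻¹ • ∫ θ in (0:ℝ)..2 * Real.pi, f (c (circleMap 0 1 θ)))) := by
    apply Tendsto.const_smul
    apply intervalIntegral.tendsto_integral_filter_of_dominated_convergence (fun _ => 1)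
    · filter_upwards [Ioo_mem_nhdsLT (zero_lt_one' ℝ)] with r hr
      apply Continuous.aestronglyMeasurable
      rw [continuous_iff_continuousAt]
      intro θ
      have hn : ‖circleMap 0 r θ‖ < 1 := by
        rw [norm_circleMap_zero, abs_of_pos hr.1]; exact hr.2
      exact ContinuousAt.comp (f := circleMap 0 r) (g := f ∘ c) (hgd _ hn.le (hne _ hn)).continuousAt
        (continuous_circleMap 0 r).continuousAt
    · filter_upwards [Ioo_mem_nhdsLT (zero_lt_one' ℝ)] with r hr
      refine Eventually.of_forall fun θ _ => hb _ (him _ ?_)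
      rw [norm_circleMap_zero, abs_of_pos hr.1]; exact hr.2.le
    · simp
    · have : ∀ᵐ θ : ℝ, θ ≠ Real.pi := by simp [ae_iff]
      filter_upwards [this] with θ hθ hmem
      rw [Set.uIoc_of_le (by positivity)] at hmem
      have h1 : 1 + circleMap 0 1 θ ≠ 0 := by
        intro h
        have hre := congrArg Complex.re h
        simp [circleMap, Complex.exp_ofReal_mul_I_re] at hre
        have h2 : Real.cos (θ - Real.pi) = 1 := by rw [Real.cos_sub_pi]; linarith
        have h3 := (Real.cos_eq_one_iff_of_lt_of_lt (by linarith [hmem.1, Real.pi_pos])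
          (by linarith [hmem.2, Real.pi_pos])).1 h2
        exact hθ (by linarith)
      have h2 : ContinuousAt (fun r : ℝ => circleMap 0 r θ) 1 := by
        unfold circleMap; fun_prop
      have h3 := ContinuousAt.comp (f := fun r : ℝ => circleMap 0 r θ) (g := f ∘ c) (x := 1)
        (hgd _ (by simp) h1).continuousAt h2
      exact h3.tendsto.mono_left nhdsWithin_le_nhds
  have hc0 : c 0 = x0 + ((y0 + η : ℝ) : ℂ) * Complex.I := by
    simp [hc]; ring
  rw [← hc0]
  have huniq := tendsto_nhds_unique hlim ((tendsto_const_nhds (x := f (c 0))).congr' (by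
    filter_upwards [Ioo_mem_nhdsLT (zero_lt_one' ℝ)] with r hr using (hmv r hr).symm))
  rw [← huniq]
  congr 1
  apply intervalIntegral.integral_congr_ae
  have : ∀ᵐ θ : ℝ, θ ≠ Real.pi := by simp [ae_iff]
  filter_upwards [this] with θ hθ hmem
  rw [Set.uIoc_of_le (by positivity)] at hmem
  have hcos : Real.cos (θ / 2) ≠ 0 := by
    intro h
    have h2 : Real.cos (θ - Real.pi) = 1 := by
      rw [Real.cos_sub_pi]
      have := Real.cos_sq (θ / 2)
      rw [h, mul_div_cancel₀ _ (two_ne_zero)] at this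
      linarith
    have h3 := (Real.cos_eq_one_iff_of_lt_of_lt (by linarith [hmem.1, Real.pi_pos])
      (by linarith [hmem.2, Real.pi_pos])).1 h2
    exact hθ (by linarith)
  congr 1
  have hE : circleMap 0 1 θ = ((Real.cos (θ / 2) : ℂ) + Real.sin (θ / 2) * Complex.I) ^ 2 := by
    rw [Complex.ofReal_cos, Complex.ofReal_sin, ← Complex.exp_mul_I, ← Complex.exp_nat_mul]
    simp [circleMap]; congr 1; ring
  have hone : (Real.cos (θ / 2) : ℂ) ^ 2 + (Real.sin (θ / 2) : ℂ) ^ 2 = 1 := by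
    exact_mod_cast Real.cos_sq_add_sin_sq (θ / 2)
  simp only [hc, hE, Complex.ofReal_add, Complex.ofReal_mul, Complex.ofReal_div]
  have hC : (Real.cos (θ / 2) : ℂ) ≠ 0 := by exact_mod_cast hcos
  generalize (Real.cos (θ / 2) : ℂ) = C at *
  generalize (Real.sin (θ / 2) : ℂ) = S at *
  have hCS : C + S * Complex.I ≠ 0 := by
    intro h
    have : (C + S * Complex.I) * (C - S * Complex.I) = 1 := by
      linear_combination hone - S ^ 2 * Complex.I_sq
    rw [h] at this; simp at this
  have h1 : 1 + (C + S * Complex.I) ^ 2 = 2 * C * (C + S * Complex.I) := by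
    linear_combination -hone + S ^ 2 * Complex.I_sq
  have h2 : 1 - (C + S * Complex.I) ^ 2 = -2 * Complex.I * S * (C + S * Complex.I) := by
    linear_combination -hone + S ^ 2 * Complex.I_sq
  have h3 : (1 - (C + S * Complex.I) ^ 2) / (1 + (C + S * Complex.I) ^ 2) =
      - Complex.I * (S / C) := by
    rw [h1, h2, mul_div_mul_right _ _ hCS]; field_simp
  rw [h3]
  linear_combination -(y0 : ℂ) * (S / C) * Complex.I_sq


lemma null_transfer (x0 y0 : ℝ) (hy : 0 < y0) (P : ℝ → Prop) (hP : ∀ᵐ x : ℝ, P x) :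
    ∀ᵐ θ : ℝ, θ ∈ Set.Ioc 0 (2 * Real.pi) →
      P (x0 + y0 * (Real.sin (θ / 2) / Real.cos (θ / 2))) := by
  set N : Set ℝ := {x | ¬ P x} with hN
  have hN0 : volume N = 0 := hP
  have harc : Differentiable ℝ (fun t => 2 * Real.arctan ((t - x0) / y0)) :=
    (Real.differentiable_arctan.comp (by fun_prop :
      Differentiable ℝ fun t : ℝ => (t - x0) / y0)).const_mul 2
  have n1 : volume ((fun t => 2 * Real.arctan ((t - x0) / y0)) '' N) = 0 := by
    apply addHaar_image_eq_zero_of_differentiableOn_of_addHaar_eq_zero volume _ hN0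
    exact harc.differentiableOn
  have n2 : volume ((fun t => 2 * Real.arctan ((t - x0) / y0) + 2 * Real.pi) '' N) = 0 := by
    apply addHaar_image_eq_zero_of_differentiableOn_of_addHaar_eq_zero volume _ hN0
    exact (harc.add_const _).differentiableOn
  have : ∀ᵐ θ : ℝ, θ ≠ Real.pi := by simp [ae_iff]
  filter_upwards [this, measure_eq_zero_iff_ae_notMem.1 n1, measure_eq_zero_iff_ae_notMem.1 n2]
    with θ h0 h1 h2 hmem
  by_contra hcon
  rw [← Real.tan_eq_sin_div_cos] at hcon
  rcases lt_or_gt_of_ne h0 with h | h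
  · refine h1 ⟨_, hcon, ?_⟩
    simp only [add_sub_cancel_left]
    rw [mul_div_cancel_left₀ _ hy.ne', Real.arctan_tan (by linarith [hmem.1, Real.pi_pos])
      (by linarith)]
    ring
  · refine h2 ⟨_, hcon, ?_⟩
    simp only [add_sub_cancel_left]
    rw [mul_div_cancel_left₀ _ hy.ne', ← Real.tan_sub_pi, Real.arctan_tan (by linarith)
      (by linarith [hmem.2, Real.pi_pos])]
    ring

lemma exp_re (w : ℂ) : (Complex.exp (-Complex.I * w / 2)).re =
    Real.exp (w.im / 2) * Real.cos (w.re / 2) := by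
  rw [Complex.exp_re]
  have h1 : (-Complex.I * w / 2).re = w.im / 2 := by
    simp
  have h2 : (-Complex.I * w / 2).im = -(w.re / 2) := by
    simp [neg_div]
  rw [h1, h2, Real.cos_neg]

lemma uhp_re_nonneg (C : ℂ → ℂ) (hC : DifferentiableOn ℂ C {z | 0 < z.im})
    (hIm : ∀ z : ℂ, 0 < z.im → (C z).im ≤ 0)
    (hb : ∀ᵐ x : ℝ, ∃ L : ℝ, |L| ≤ Real.pi ∧ Tendsto (fun η : ℝ => (C (x + η * Complex.I)).re)
      (nhdsWithin 0 (Set.Ioi 0)) (nhds L)) (z : ℂ) (hz : 0 < z.im) :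
    0 ≤ Real.cos ((C z).re / 2) := by
  have hopen : IsOpen {z : ℂ | 0 < z.im} := isOpen_lt continuous_const Complex.continuous_im
  set f : ℂ → ℂ := fun z => Complex.exp (-Complex.I * C z / 2) with hf
  have hfd : DifferentiableOn ℂ f {z | 0 < z.im} := by
    simp only [hf]
    exact ((hC.const_mul _).div_const _).cexp
  have hfb : ∀ z : ℂ, 0 < z.im → ‖f z‖ ≤ 1 := by
    intro z hz
    simp only [hf, Complex.norm_exp]
    rw [Real.exp_le_one_iff]
    have := hIm z hz
    simp; linarith
  suffices h : 0 ≤ (f z).re by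
    simp only [hf, exp_re] at h
    exact nonneg_of_mul_nonneg_right h (Real.exp_pos _)
  set X : ℝ → ℝ := fun θ => z.re + z.im * (Real.sin (θ / 2) / Real.cos (θ / 2)) with hX
  have hXm : Measurable X := by simp only [hX]; fun_prop
  set m : ℝ → ℝ → ℝ := fun η θ => min (Real.cos ((C (X θ + η * Complex.I)).re / 2)) 0 with hm
  have hline : ∀ η : ℝ, 0 < η → Continuous fun x : ℝ => C (x + η * Complex.I) := by
    intro η hη
    refine hC.continuousOn.comp_continuous (by fun_prop) (fun x => ?_)
    simpa using hη
  have hmm : ∀ η : ℝ, 0 < η → Measurable (m η) := by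
    intro η hη
    simp only [hm]
    exact Measurable.min (Real.measurable_cos.comp ((Complex.measurable_re.comp
      ((hline η hη).measurable.comp hXm)).div_const 2)) measurable_const
  have hmb : ∀ η θ, ‖m η θ‖ ≤ 1 := by
    intro η θ
    simp only [hm, Real.norm_eq_abs]
    rw [abs_le]
    refine ⟨le_min (Real.neg_one_le_cos _) (by norm_num), (min_le_right _ _).trans (by norm_num)⟩
  have hmlim : Tendsto (fun η => (2 * Real.pi)⁻¹ • ∫ θ in (0:ℝ)..2 * Real.pi, m η θ)
      (nhdsWithin 0 (Set.Ioi 0)) (nhds ((2 * Real.pi)⁻¹ • ∫ θ in (0:ℝ)..2 * Real.pi, (0:ℝ))) := by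
    apply Tendsto.const_smul
    apply intervalIntegral.tendsto_integral_filter_of_dominated_convergence (fun _ => 1)
    · filter_upwards [self_mem_nhdsWithin] with η hη using (hmm η hη).aestronglyMeasurable
    · exact Eventually.of_forall fun η => Eventually.of_forall fun θ _ => hmb η θ
    · simp
    · filter_upwards [null_transfer z.re z.im hz _ hb] with θ hθ hmem
      rw [Set.uIoc_of_le (by positivity)] at hmem
      obtain ⟨L, hL, ht⟩ := hθ hmem
      have h1 : Tendsto (fun η => m η θ) (nhdsWithin 0 (Set.Ioi 0))
          (nhds (min (Real.cos (L / 2)) 0)) :=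
        ((Real.continuous_cos.tendsto _).comp (ht.div_const 2)).min tendsto_const_nhds
      have h2 : 0 ≤ Real.cos (L / 2) := by
        rw [abs_le] at hL
        exact Real.cos_nonneg_of_mem_Icc ⟨by linarith, by linarith⟩
      rwa [min_eq_right h2] at h1
  have hflim : Tendsto (fun η : ℝ => (f (z.re + ((z.im + η : ℝ) : ℂ) * Complex.I)).re)
      (nhdsWithin 0 (Set.Ioi 0)) (nhds (f z).re) := by
    have h1 : ContinuousAt f z := (hfd.differentiableAt (hopen.mem_nhds hz)).continuousAt
    have h2 : Tendsto (fun η : ℝ => (z.re + ((z.im + η : ℝ) : ℂ) * Complex.I)) (nhds 0) (nhds z) := by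
      have : Continuous (fun η : ℝ => (z.re + ((z.im + η : ℝ) : ℂ) * Complex.I)) := by fun_prop
      have := this.tendsto 0
      simpa [Complex.re_add_im] using this
    exact ((Complex.continuous_re.tendsto _).comp (h1.tendsto.comp h2)).mono_left nhdsWithin_le_nhds
  simp only [intervalIntegral.integral_zero, smul_zero] at hmlim
  refine le_of_tendsto_of_tendsto hmlim hflim ?_
  filter_upwards [self_mem_nhdsWithin] with η hη
  have hη : 0 < η := hη
  have hlow : ∀ θ, m η θ ≤ (f (X θ + η * Complex.I)).re := by
    intro θ
    simp only [hf, exp_re, hm]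
    have him := hIm (X θ + η * Complex.I) (by simpa using hη)
    have he : Real.exp ((C (X θ + η * Complex.I)).im / 2) ≤ 1 := by
      rw [Real.exp_le_one_iff]; linarith
    have he0 := Real.exp_pos ((C (X θ + η * Complex.I)).im / 2)
    rcases le_total (Real.cos ((C (X θ + η * Complex.I)).re / 2)) 0 with h | h
    · rw [min_eq_left h]; nlinarith
    · rw [min_eq_right h]; positivity
  have hfline : Continuous fun x : ℝ => f (x + η * Complex.I) := by
    exact Complex.continuous_exp.comp ((continuous_const.mul (hline η hη)).div_const 2)
  have hfi : IntervalIntegrable (fun θ => f (X θ + η * Complex.I)) volume 0 (2 * Real.pi) := by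
    refine (intervalIntegrable_const (c := (1:ℝ))).mono_fun ?_ ?_
    · exact (hfline.measurable.comp hXm).aestronglyMeasurable
    · refine Eventually.of_forall fun θ => ?_
      simpa using hfb (X θ + η * Complex.I) (by simpa using hη)
  have hmi : IntervalIntegrable (m η) volume 0 (2 * Real.pi) := by
    refine (intervalIntegrable_const (c := (1:ℝ))).mono_fun (hmm η hη).aestronglyMeasurable ?_
    exact Eventually.of_forall fun θ => by simpa using hmb η θ
  rw [mean_line f hfd hfb z.re z.im η hz hη, Complex.smul_re]
  have hre : (∫ θ in (0:ℝ)..2 * Real.pi, f (X θ + η * Complex.I)).re =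
      ∫ θ in (0:ℝ)..2 * Real.pi, (f (X θ + η * Complex.I)).re :=
    (Complex.reCLM.intervalIntegral_comp_comm hfi).symm
  simp only [hX] at hre
  rw [hre, smul_eq_mul, smul_eq_mul]
  apply mul_le_mul_of_nonneg_left _ (by positivity)
  apply intervalIntegral.integral_mono_on (by positivity) hmi
  · exact (Complex.reCLM.integrable_comp hfi.1 |> fun h1 => ⟨h1, Complex.reCLM.integrable_comp hfi.2⟩)
  · intro θ _; exact hlow θ

lemma uhp_bound (C : ℂ → ℂ) (hC : DifferentiableOn ℂ C {z | 0 < z.im})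
    (hIm : ∀ z : ℂ, 0 < z.im → (C z).im ≤ 0)
    (hb : ∀ᵐ x : ℝ, ∃ L : ℝ, |L| ≤ Real.pi ∧ Tendsto (fun η : ℝ => (C (x + η * Complex.I)).re)
      (nhdsWithin 0 (Set.Ioi 0)) (nhds L))
    (hinf : ∀ z : ℂ, Tendsto (fun t : ℝ => C (z + t * Complex.I)) atTop (nhds 0))
    (z : ℂ) (hz : 0 < z.im) : |(C z).re| ≤ Real.pi := by
  by_contra hcon
  push Not at hcon
  set a : ℝ → ℝ := fun t => |(C (z + t * Complex.I)).re| with ha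
  have ha0 : a 0 = |(C z).re| := by simp [ha]
  have hlim : Tendsto a atTop (nhds 0) := by
    have := ((Complex.continuous_re.tendsto _).comp (hinf z)).abs
    simpa using this
  obtain ⟨T, hT, hT0⟩ := ((hlim.eventually (gt_mem_nhds Real.pi_pos)).and
    (eventually_ge_atTop 0)).exists
  have him : ∀ t : ℝ, 0 ≤ t → 0 < (z + t * Complex.I).im := by
    intro t ht; simp; linarith
  have hcont : ContinuousOn a (Set.Icc 0 T) := by
    simp only [ha]
    apply ContinuousOn.abs
    apply Complex.continuous_re.comp_continuousOn
    exact hC.continuousOn.comp (by fun_prop) (fun t ht => him t ht.1)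
  have hv1 : Real.pi < min (a 0) (2 * Real.pi) :=
    lt_min (by rw [ha0]; exact hcon) (by linarith [Real.pi_pos])
  obtain ⟨t, ht, hat⟩ := intermediate_value_Icc' hT0 hcont
    (show min (a 0) (2 * Real.pi) ∈ Set.Icc (a T) (a 0) from ⟨by linarith, min_le_left _ _⟩)
  have h1 := uhp_re_nonneg C hC hIm hb _ (him t ht.1)
  rw [← Real.cos_abs, abs_div, abs_two] at h1
  change 0 ≤ Real.cos (a t / 2) at h1
  have h2 : a t ≤ 2 * Real.pi := by rw [hat]; exact min_le_right _ _
  have h3 : Real.cos (a t / 2) < 0 :=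
    Real.cos_neg_of_pi_div_two_lt_of_lt (by linarith) (by linarith [Real.pi_pos])
  linarith


lemma holo_param (F : ℝ → ℝ) (hF : Integrable F) (I : Set ℝ)
    (h0 : ∀ᵐ t : ℝ, t ∉ I → F t = 0) (K K' : ℂ → ℝ → ℂ) (z0 : ℂ) (s : Set ℂ) (hs : s ∈ nhds z0)
    (M : ℝ) (hKm : ∀ z, Measurable (K z)) (hK'm : ∀ z, Measurable (K' z))
    (hKb : ∀ t ∈ I, ‖K z0 t‖ ≤ M) (hK'b : ∀ z ∈ s, ∀ t ∈ I, ‖K' z t‖ ≤ M)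
    (hd : ∀ z ∈ s, ∀ t ∈ I, HasDerivAt (fun z => K z t) (K' z t) z) :
    HasDerivAt (fun z => ∫ t : ℝ, (F t : ℂ) * K z t) (∫ t : ℝ, (F t : ℂ) * K' z0 t) z0 := by
  have hFm : AEStronglyMeasurable (fun t => (F t : ℂ)) := hF.ofReal.aestronglyMeasurable
  have hbi : Integrable (fun t => |F t| * M) := hF.abs.mul_const M
  refine (hasDerivAt_integral_of_dominated_loc_of_deriv_le (bound := fun t => |F t| * M)
    (F := fun z t => (F t : ℂ) * K z t) (F' := fun z t => (F t : ℂ) * K' z t) hs ?_ ?_ ?_ ?_ hbi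
    ?_).2
  · exact Eventually.of_forall fun z => hFm.mul (hKm z).aestronglyMeasurable
  · refine hbi.mono' (hFm.mul (hKm z0).aestronglyMeasurable) ?_
    filter_upwards [h0] with t ht
    by_cases h : t ∈ I
    · rw [norm_mul, Complex.norm_real, Real.norm_eq_abs]
      exact mul_le_mul_of_nonneg_left (hKb t h) (abs_nonneg _)
    · rw [ht h]; simp
  · exact hFm.mul (hK'm z0).aestronglyMeasurable
  · filter_upwards [h0] with t ht z hz
    by_cases h : t ∈ I
    · rw [norm_mul, Complex.norm_real, Real.norm_eq_abs]
      exact mul_le_mul_of_nonneg_left (hK'b z hz t h) (abs_nonneg _)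
    · rw [ht h]; simp
  · filter_upwards [h0] with t ht z hz
    by_cases h : t ∈ I
    · exact (hd z hz t h).const_mul _
    · rw [ht h]; simpa using hasDerivAt_const z (0:ℂ)

lemma norm_ge_im (z : ℂ) (t : ℝ) : z.im ≤ ‖z - t‖ := by
  have := Complex.abs_im_le_norm (z - t)
  simp at this
  exact (le_abs_self _).trans this

lemma cau_diff (F : ℝ → ℝ) (hF : Integrable F) : DifferentiableOn ℂ (cau F) {z | 0 < z.im} := by
  intro z hz
  have hz : 0 < z.im := hz
  have hopen : IsOpen {w : ℂ | z.im / 2 < w.im} := isOpen_lt continuous_const Complex.continuous_im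
  have hne : ∀ w : ℂ, 0 < w.im → ∀ t : ℝ, w - t ≠ 0 := by
    intro w hw t h
    have := norm_ge_im w t
    rw [h, norm_zero] at this; linarith
  have := holo_param F hF Set.univ (by simp) (fun z t => 1 / (z - t))
    (fun z t => -1 / (z - t) ^ 2) z {w : ℂ | z.im / 2 < w.im}
    (hopen.mem_nhds (by simp; linarith)) (max (1 / z.im) (1 / (z.im / 2) ^ 2))
    (fun z => by fun_prop) (fun z => by fun_prop) ?_ ?_ ?_
  · exact this.differentiableAt.differentiableWithinAt
  · intro t _
    refine le_max_of_le_left ?_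
    rw [norm_div, norm_one]
    exact one_div_le_one_div_of_le hz (norm_ge_im z t)
  · intro w hw t _
    have hw : z.im / 2 < w.im := hw
    refine le_max_of_le_right ?_
    rw [norm_div, norm_neg, norm_one, norm_pow]
    apply one_div_le_one_div_of_le (by positivity)
    have := norm_ge_im w t
    gcongr
    linarith
  · intro w hw t _
    have hw : z.im / 2 < w.im := hw
    have h1 := hne w (by linarith) t
    have h2 : HasDerivAt (fun z : ℂ => z - t) 1 w := (hasDerivAt_id w).sub_const _
    have h3 := h2.inv h1
    simp only [one_div]
    exact h3

lemma cau_im (F : ℝ → ℝ) (hF : Integrable F) (hpos : ∀ᵐ x : ℝ, 0 ≤ F x) (z : ℂ) (hz : 0 < z.im) :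
    (cau F z).im ≤ 0 := by
  have h1 : (cau F z).im = ∫ s : ℝ, ((F s : ℂ) * (1 / (z - s))).im :=
    (Complex.imCLM.integral_comp_comm (cau_integrable F hF z hz)).symm
  rw [h1]
  apply integral_nonpos_of_ae
  filter_upwards [hpos] with s hs
  rw [Complex.im_ofReal_mul, one_div, Complex.inv_im]
  simp only [Complex.sub_im, Complex.ofReal_im, sub_zero, Pi.zero_apply]
  apply mul_nonpos_of_nonneg_of_nonpos hs
  exact div_nonpos_of_nonpos_of_nonneg (by linarith) (Complex.normSq_nonneg _)

lemma cau_inf (F : ℝ → ℝ) (hF : Integrable F) (z : ℂ) :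
    Tendsto (fun t : ℝ => cau F (z + t * Complex.I)) atTop (nhds 0) := by
  have h1 : Tendsto (fun t : ℝ => (∫ s, |F s|) * (z.im + t)⁻¹) atTop (nhds ((∫ s, |F s|) * 0)) :=
    (tendsto_inv_atTop_zero.comp (tendsto_atTop_add_const_left _ _ tendsto_id)).const_mul _
  rw [mul_zero] at h1
  refine squeeze_zero_norm' ?_ h1
  filter_upwards [eventually_gt_atTop (-z.im)] with t ht
  rw [← integral_mul_const]
  refine norm_integral_le_of_norm_le (hF.abs.mul_const _) (Eventually.of_forall fun s => ?_)
  rw [norm_mul, Complex.norm_real, Real.norm_eq_abs, norm_div, norm_one, one_div]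
  have := norm_ge_im (z + t * Complex.I) s
  have h2 : (z + t * Complex.I).im = z.im + t := by simp
  rw [h2] at this
  have h3 : 0 < z.im + t := by linarith
  gcongr

/-- The Cauchy transform in the disc variable `z = (s + 1/s)/4`. -/
noncomputable def dfun (F : ℝ → ℝ) (s : ℂ) : ℂ := ∫ t : ℝ, (F t : ℂ) * (4 * s / (s ^ 2 + 1 - 4 * t * s))

lemma dfun_eq_cau (F : ℝ → ℝ) (s : ℂ) (hs : s ≠ 0) : dfun F s = cau F ((s ^ 2 + 1) / (4 * s)) := by
  unfold dfun cau
  congr 1; ext t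
  congr 1
  have : (s ^ 2 + 1) / (4 * s) - t = (s ^ 2 + 1 - 4 * t * s) / (4 * s) := by
    field_simp
  rw [this, one_div_div]

lemma dfun_conj (F : ℝ → ℝ) (s : ℂ) :
    dfun F ((starRingEnd ℂ) s) = (starRingEnd ℂ) (dfun F s) := by
  unfold dfun
  rw [← integral_conj]
  congr 1; ext t
  have h4 : (starRingEnd ℂ) (4:ℂ) = 4 := Complex.conj_ofReal 4
  simp [h4]

lemma den_bound (s : ℂ) (hs : ‖s‖ < 1) (t : ℝ) (ht : t ∈ Set.Icc (-(1/2) : ℝ) (1/2)) :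
    (1 - ‖s‖) ^ 2 ≤ ‖s ^ 2 + 1 - 4 * t * s‖ := by
  set e : ℂ := ⟨2 * t, Real.sqrt (1 - 4 * t ^ 2)⟩ with he
  have hsq : Real.sqrt (1 - 4 * t ^ 2) ^ 2 = 1 - 4 * t ^ 2 :=
    Real.sq_sqrt (by nlinarith [ht.1, ht.2])
  have hn : ‖e‖ = 1 := by
    have : ‖e‖ ^ 2 = 1 := by
      rw [← Complex.normSq_eq_norm_sq, Complex.normSq_apply]
      simp only [he]; nlinarith
    nlinarith [norm_nonneg e]
  have h1 : e * (starRingEnd ℂ) e = 1 := by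
    rw [Complex.mul_conj, Complex.normSq_eq_norm_sq, hn]; simp
  have h2 : e + (starRingEnd ℂ) e = 4 * t := by
    rw [Complex.add_conj]; simp only [he]; push_cast; ring
  have h3 : s ^ 2 + 1 - 4 * t * s = (s - e) * (s - (starRingEnd ℂ) e) := by
    linear_combination s * h2 - h1
  rw [h3, norm_mul, sq]
  have h4 : 1 - ‖s‖ ≤ ‖s - e‖ := by
    have := norm_sub_norm_le e s
    rw [hn, norm_sub_rev] at this; exact this
  have h5 : 1 - ‖s‖ ≤ ‖s - (starRingEnd ℂ) e‖ := by
    have := norm_sub_norm_le ((starRingEnd ℂ) e) s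
    rw [RCLike.norm_conj, hn, norm_sub_rev] at this; exact this
  exact mul_le_mul h4 h5 (by linarith) (norm_nonneg _)

lemma dfun_deriv (F : ℝ → ℝ) (hF : Integrable F)
    (h0 : ∀ᵐ x ∂(volume : Measure ℝ), x ∉ Set.Icc (-(1/2) : ℝ) (1/2) → F x = 0)
    (s0 : ℂ) (hs0 : ‖s0‖ < 1) : HasDerivAt (dfun F)
      (∫ t : ℝ, (F t : ℂ) * (4 * (1 - s0 ^ 2) / (s0 ^ 2 + 1 - 4 * t * s0) ^ 2)) s0 := by
  set d := (1 - ‖s0‖) / 2 with hd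
  have hdpos : 0 < d := by simp only [hd]; linarith
  have hball : ∀ s ∈ Metric.ball s0 d, ‖s‖ < 1 - d := by
    intro s hs
    rw [mem_ball_iff_norm] at hs
    have := norm_le_norm_add_norm_sub' s s0
    simp only [hd] at *; linarith
  have hden : ∀ s ∈ Metric.ball s0 d, ∀ t ∈ Set.Icc (-(1/2) : ℝ) (1/2),
      d ^ 2 ≤ ‖s ^ 2 + 1 - 4 * t * s‖ := by
    intro s hs t ht
    have h1 := hball s hs
    refine le_trans ?_ (den_bound s (by linarith) t ht)
    gcongr; linarith
  have hself : s0 ∈ Metric.ball s0 d := Metric.mem_ball_self hdpos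
  refine holo_param F hF _ h0 (fun s t => 4 * s / (s ^ 2 + 1 - 4 * t * s))
    (fun s t => 4 * (1 - s ^ 2) / (s ^ 2 + 1 - 4 * t * s) ^ 2) s0 (Metric.ball s0 d)
    (Metric.ball_mem_nhds s0 hdpos) (max (4 / d ^ 2) (8 / (d ^ 2) ^ 2))
    (fun s => by fun_prop) (fun s => by fun_prop) ?_ ?_ ?_
  · intro t ht
    refine le_max_of_le_left ?_
    rw [norm_div, norm_mul]
    have := hden s0 hself t ht
    have h4 : ‖(4:ℂ)‖ = 4 := by simp
    rw [h4]
    apply div_le_div₀ (by norm_num) (by linarith) (by positivity) this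
  · intro s hs t ht
    refine le_max_of_le_right ?_
    rw [norm_div, norm_mul, norm_pow]
    have := hden s hs t ht
    have h4 : ‖(4:ℂ)‖ = 4 := by simp
    have h5 : ‖1 - s ^ 2‖ ≤ 2 := by
      refine (norm_sub_le _ _).trans ?_
      rw [norm_one, norm_pow]
      have := hball s hs
      nlinarith [norm_nonneg s]
    rw [h4]
    apply div_le_div₀ (by norm_num) (by linarith) (by positivity)
    gcongr
  · intro s hs t ht
    have hne : s ^ 2 + 1 - 4 * t * s ≠ 0 := by
      intro h
      have := hden s hs t ht
      rw [h, norm_zero] at this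
      have : 0 < d ^ 2 := by positivity
      linarith
    have h1 : HasDerivAt (fun s : ℂ => 4 * s) 4 s := by
      simpa using (hasDerivAt_id s).const_mul (4:ℂ)
    have h2 : HasDerivAt (fun s : ℂ => s ^ 2 + 1 - 4 * t * s) (2 * s - 4 * t) s := by
      have := (((hasDerivAt_id s).pow 2).add_const (1:ℂ)).sub ((hasDerivAt_id s).const_mul (4 * (t:ℂ)))
      refine HasDerivAt.congr_deriv this ?_
      simp
    refine (h1.fun_div h2 hne).congr_deriv ?_
    ring

lemma dfun_re (F : ℝ → ℝ) (hF : Integrable F)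
    (h0 : ∀ᵐ x ∂(volume : Measure ℝ), x ∉ Set.Icc (-(1/2) : ℝ) (1/2) → F x = 0)
    (hC : ∀ z : ℂ, 0 < z.im → |(cau F z).re| ≤ Real.pi) (s : ℂ) (hs : ‖s‖ < 1) :
    |(dfun F s).re| ≤ Real.pi := by
  have hneg : ∀ s : ℂ, ‖s‖ < 1 → s.im < 0 → |(dfun F s).re| ≤ Real.pi := by
    intro s hs him
    have hs0 : s ≠ 0 := by rintro rfl; simp at him
    rw [dfun_eq_cau F s hs0]
    apply hC
    have h1 : (s ^ 2 + 1) / (4 * s) = (s + s⁻¹) / 4 := by field_simp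
    have h2 : ((s + s⁻¹) / 4).im = (s.im + s⁻¹.im) / 4 := by simp
    rw [h1, h2, Complex.inv_im]
    have h3 : Complex.normSq s < 1 := by
      rw [Complex.normSq_eq_norm_sq]; nlinarith [norm_nonneg s]
    have h4 : 0 < Complex.normSq s := Complex.normSq_pos.2 hs0
    have h5 : -s.im < -s.im / Complex.normSq s := by
      rw [lt_div_iff₀ h4]; nlinarith
    linarith
  rcases lt_trichotomy s.im 0 with h | h | h
  · exact hneg s hs h
  · have hcont : ContinuousAt (dfun F) s := (dfun_deriv F hF h0 s hs).continuousAt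
    have hp : Tendsto (fun ε : ℝ => s - ε * Complex.I) (nhdsWithin 0 (Set.Ioi 0)) (nhds s) := by
      have : Continuous fun ε : ℝ => s - ε * Complex.I := by fun_prop
      have := this.tendsto 0
      simp only [Complex.ofReal_zero, zero_mul, sub_zero] at this
      exact this.mono_left nhdsWithin_le_nhds
    have h1 := ((Complex.continuous_re.tendsto _).comp (hcont.tendsto.comp hp)).abs
    refine le_of_tendsto h1 ?_
    have h2 : ∀ᶠ w in nhds s, ‖w‖ < 1 := continuous_norm.continuousAt.eventually (gt_mem_nhds hs)
    filter_upwards [self_mem_nhdsWithin, hp.eventually h2] with ε hε hn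
    have hε : 0 < ε := hε
    exact hneg _ hn (by simp [h, hε])
  · have := hneg ((starRingEnd ℂ) s) (by simpa using hs) (by simpa using h)
    rw [dfun_conj] at this
    simpa using this

lemma tan_bound (w : ℂ) (hw : |w.re| ≤ Real.pi / 4) : Complex.cos w ≠ 0 ∧ ‖Complex.tan w‖ ≤ 1 := by
  have hs : ‖Complex.sin w‖ ^ 2 = Real.sin w.re ^ 2 + Real.sinh w.im ^ 2 := by
    rw [← Complex.normSq_eq_norm_sq, Complex.normSq_apply]
    have h1 : Complex.sin w = ((Real.sin w.re * Real.cosh w.im : ℝ) : ℂ)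
        + (Real.cos w.re * Real.sinh w.im : ℝ) * Complex.I := by
      conv_lhs => rw [Complex.sin_eq]
      push_cast; ring
    rw [h1]
    simp only [Complex.add_re, Complex.add_im, Complex.ofReal_re, Complex.ofReal_im, Complex.mul_re,
      Complex.mul_im, Complex.I_re, Complex.I_im]
    have := Real.cosh_sq w.im
    have := Real.sin_sq_add_cos_sq w.re
    grind
  have hc : ‖Complex.cos w‖ ^ 2 = Real.cos w.re ^ 2 + Real.sinh w.im ^ 2 := by
    rw [← Complex.normSq_eq_norm_sq, Complex.normSq_apply]
    have h1 : Complex.cos w = ((Real.cos w.re * Real.cosh w.im : ℝ) : ℂ)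
        - (Real.sin w.re * Real.sinh w.im : ℝ) * Complex.I := by
      conv_lhs => rw [Complex.cos_eq]
      push_cast; ring
    rw [h1]
    simp only [Complex.sub_re, Complex.sub_im, Complex.ofReal_re, Complex.ofReal_im, Complex.mul_re,
      Complex.mul_im, Complex.I_re, Complex.I_im]
    have := Real.cosh_sq w.im
    have := Real.sin_sq_add_cos_sq w.re
    grind
  rw [abs_le] at hw
  have hpi := Real.pi_pos
  have hcpos : 0 < Real.cos w.re := Real.cos_pos_of_mem_Ioo ⟨by linarith, by linarith⟩
  have h2 : 0 ≤ Real.cos (2 * w.re) := Real.cos_nonneg_of_mem_Icc ⟨by linarith, by linarith⟩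
  rw [Real.cos_two_mul] at h2
  have h3 := Real.sin_sq_add_cos_sq w.re
  have hne : Complex.cos w ≠ 0 := by
    intro h
    rw [h, norm_zero] at hc
    nlinarith [sq_nonneg (Real.sinh w.im)]
  refine ⟨hne, ?_⟩
  rw [Complex.tan_eq_sin_div_cos, norm_div, div_le_one (norm_pos_iff.2 hne)]
  apply le_of_sq_le_sq _ (norm_nonneg _)
  rw [hs, hc]; nlinarith

lemma tan_dfun (F : ℝ → ℝ) (hF : Integrable F)
    (h0 : ∀ᵐ x ∂(volume : Measure ℝ), x ∉ Set.Icc (-(1/2) : ℝ) (1/2) → F x = 0)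
    (hmass : ∫ x : ℝ, F x = 1)
    (hC : ∀ z : ℂ, 0 < z.im → |(cau F z).re| ≤ Real.pi) (s : ℂ) (hs : ‖s‖ < 1) :
    Complex.cos (dfun F s / 4) ≠ 0 ∧ Complex.tan (dfun F s / 4) = s := by
  have hb : ∀ s : ℂ, ‖s‖ < 1 → |(dfun F s / 4).re| ≤ Real.pi / 4 := by
    intro s hs
    have := dfun_re F hF h0 hC s hs
    have h4 : (dfun F s / 4).re = (dfun F s).re / 4 := by simp
    rw [h4, abs_div, abs_of_pos (by norm_num : (0:ℝ) < 4)]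
    linarith
  refine ⟨(tan_bound _ (hb s hs)).1, ?_⟩
  set B : ℂ → ℂ := fun s => Complex.tan (dfun F s / 4) with hB
  have hd0 : dfun F 0 = 0 := by simp [dfun]
  have hB0 : B 0 = 0 := by simp [hB, hd0]
  have hBd : DifferentiableOn ℂ B (Metric.ball 0 1) := by
    intro s hs
    have hs : ‖s‖ < 1 := by simpa using hs
    have h1 := (dfun_deriv F hF h0 s hs).differentiableAt.div_const 4
    exact ((Complex.differentiableAt_tan.2 (tan_bound _ (hb s hs)).1).comp s h1).differentiableWithinAt
  have hmaps : Set.MapsTo B (Metric.ball 0 1) (Metric.closedBall (B 0) 1) := by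
    intro s hs
    have hs : ‖s‖ < 1 := by simpa using hs
    rw [hB0, mem_closedBall_zero_iff]
    exact (tan_bound _ (hb s hs)).2
  have hder : deriv B 0 = 1 := by
    have h1 := (dfun_deriv F hF h0 0 (by simp)).div_const 4
    have h2 : (∫ t : ℝ, (F t : ℂ) * (4 * (1 - (0:ℂ) ^ 2) / ((0:ℂ) ^ 2 + 1 - 4 * t * 0) ^ 2)) = 4 := by
      simp only [ne_eq, OfNat.ofNat_ne_zero, not_false_eq_true, zero_pow, sub_zero, mul_one, zero_add,
        mul_zero, one_pow, div_one]
      rw [integral_mul_const, integral_complex_ofReal, hmass]; simp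
    rw [h2] at h1
    have h3 : HasDerivAt Complex.tan (1 / Complex.cos (dfun F 0 / 4) ^ 2) (dfun F 0 / 4) :=
      Complex.hasDerivAt_tan (by rw [hd0]; simp)
    have h4 := (h3.comp (0:ℂ) h1).deriv
    rw [hd0] at h4
    simpa [hB, Function.comp_def] using h4
  have hds : dslope B 0 0 = 1 := by rw [dslope_same, hder]
  have := Complex.affine_of_mapsTo_ball_of_norm_dslope_eq_div hBd hmaps
    (Metric.mem_ball_self one_pos) (by rw [hds]; simp) (x := s) (by simpa using hs)
  have h5 : B s = s := by simpa [hB0, hder] using this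
  exact h5

lemma disc_param (z : ℂ) (hz : 0 < z.im) : ∃ s : ℂ, s ≠ 0 ∧ ‖s‖ < 1 ∧ s ^ 2 + 1 = 4 * z * s := by
  obtain ⟨w, hw⟩ := IsAlgClosed.exists_pow_nat_eq (4 * z ^ 2 - 1) (n := 2) (by norm_num)
  have hq : (2 * z + w) ^ 2 + 1 = 4 * z * (2 * z + w) := by linear_combination hw
  set s := 2 * z + w
  have hs0 : s ≠ 0 := by
    intro h; rw [h] at hq; simp at hq
  rcases lt_trichotomy ‖s‖ 1 with h | h | h
  · exact ⟨s, hs0, h, hq⟩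
  · exfalso
    have h1 : s * (starRingEnd ℂ) s = 1 := by
      rw [Complex.mul_conj, Complex.normSq_eq_norm_sq, h]; simp
    have h2 : s + (starRingEnd ℂ) s = 4 * z := by
      apply mul_left_cancel₀ hs0
      linear_combination hq + h1
    rw [Complex.add_conj] at h2
    have := congrArg Complex.im h2
    simp at this
    linarith
  · refine ⟨s⁻¹, inv_ne_zero hs0, ?_, ?_⟩
    · rw [norm_inv]; exact inv_lt_one_of_one_lt₀ h
    · field_simp
      linear_combination hq

lemma sin_cau (F : ℝ → ℝ) (hF : Integrable F)
    (h0 : ∀ᵐ x ∂(volume : Measure ℝ), x ∉ Set.Icc (-(1/2) : ℝ) (1/2) → F x = 0)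
    (hmass : ∫ x : ℝ, F x = 1)
    (hC : ∀ z : ℂ, 0 < z.im → |(cau F z).re| ≤ Real.pi) (z : ℂ) (hz : 0 < z.im) :
    2 * z * Complex.sin (cau F z / 2) = 1 := by
  obtain ⟨s, hs0, hs, hq⟩ := disc_param z hz
  have hzs : (s ^ 2 + 1) / (4 * s) = z := by
    rw [hq]; field_simp
  obtain ⟨hc, ht⟩ := tan_dfun F hF h0 hmass hC s hs
  rw [dfun_eq_cau F s hs0, hzs] at hc ht
  have h2 : cau F z / 2 = 2 * (cau F z / 4) := by ring
  rw [h2, Complex.sin_two_mul]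
  set w := cau F z / 4
  have hsin : Complex.sin w = s * Complex.cos w := by
    rw [← ht, Complex.tan_mul_cos hc]
  have h1 := Complex.sin_sq_add_cos_sq w
  rw [hsin] at h1 ⊢
  linear_combination h1 - Complex.cos w ^ 2 * hq


lemma final_alg (x f g : ℝ) (hx : x ≠ 0) (hx1 : |x| < 1/2) (hf : 0 ≤ f)
    (h : 2 * (x:ℂ) * Complex.sin (((Real.pi * g : ℝ) - (Real.pi * f : ℝ) * Complex.I) / 2) = 1) :
    f = (2 / Real.pi) * Real.log ((1 + Real.sqrt (1 - 4 * x ^ 2)) / (2 * |x|)) := by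
  have hpi := Real.pi_pos
  have hxpos : 0 < |x| := abs_pos.2 hx
  set u := Real.pi * g / 2 with hu
  set y := Real.pi * f / 2 with hy
  have hy0 : 0 ≤ y := by positivity
  have h1 : (((Real.pi * g : ℝ) - (Real.pi * f : ℝ) * Complex.I) / 2 : ℂ) = (u:ℂ) + ((-y : ℝ):ℂ) * Complex.I := by
    simp only [hu, hy]; push_cast; ring
  have h2 : Complex.sin ((u:ℂ) + ((-y : ℝ):ℂ) * Complex.I) = ((Real.sin u * Real.cosh y : ℝ) : ℂ)
        + (-(Real.cos u * Real.sinh y) : ℝ) * Complex.I := by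
    rw [Complex.sin_add_mul_I]
    push_cast
    rw [Complex.cosh_neg, Complex.sinh_neg]; ring
  rw [h1, h2] at h
  have hre' : 2 * x * (Real.sin u * Real.cosh y) = 1 := by
    generalize Real.sin u * Real.cosh y = p at h
    generalize -(Real.cos u * Real.sinh y) = q at h
    simpa using congrArg Complex.re h
  have hcs : Real.cos u * Real.sinh y = 0 := by
    generalize Real.sin u * Real.cosh y = p at h
    generalize Real.cos u * Real.sinh y = q at h ⊢
    have := congrArg Complex.im h
    simpa [hx] using this
  have hx2 : x ^ 2 < 1 / 4 := by
    rw [← sq_abs]; nlinarith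
  have hsc := Real.sin_sq_add_cos_sq u
  have hch := Real.cosh_sq y
  have hcos : Real.cos u = 0 := by
    rcases mul_eq_zero.1 hcs with h | h
    · exact h
    · exfalso
      rw [h] at hch
      have h5 : 4 * x ^ 2 * (Real.sin u ^ 2 * Real.cosh y ^ 2) = 1 := by
        linear_combination (2 * x * (Real.sin u * Real.cosh y) + 1) * hre'
      rw [hch] at h5
      nlinarith [sq_nonneg (Real.cos u), sq_nonneg x, sq_nonneg (Real.sin u)]
  have hsin : Real.sin u ^ 2 = 1 := by rw [hcos] at hsc; linarith
  have hc2 : (2 * |x| * Real.cosh y) ^ 2 = 1 := by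
    have : (2 * |x| * Real.cosh y) ^ 2 = 4 * x ^ 2 * Real.cosh y ^ 2 := by
      rw [mul_pow, mul_pow, sq_abs]; norm_num
    rw [this]
    linear_combination (2 * x * (Real.sin u * Real.cosh y) + 1) * hre' - 4 * x ^ 2 * Real.cosh y ^ 2 * hsin
  have hc1 : 2 * |x| * Real.cosh y = 1 := by
    have : 0 < 2 * |x| * Real.cosh y := by have := Real.cosh_pos y; positivity
    nlinarith
  have hs1 : Real.sqrt (1 - 4 * x ^ 2) = 2 * |x| * Real.sinh y := by
    rw [Real.sqrt_eq_iff_mul_self_eq (by linarith)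
      (by have := Real.sinh_nonneg_iff.2 hy0; positivity)]
    have : |x| ^ 2 = x ^ 2 := sq_abs x
    linear_combination -hc2 + 4 * |x| ^ 2 * hch + 4 * this
  have hexp : (1 + Real.sqrt (1 - 4 * x ^ 2)) / (2 * |x|) = Real.exp y := by
    rw [div_eq_iff (by positivity), hs1, ← Real.cosh_add_sinh]
    linear_combination -hc1
  rw [hexp, Real.log_exp, hy]
  field_simp

/-- Uniqueness of the extremizer for (EP2): if `F ∈ 𝒜*` with `∫F = 1` and the essential
supremum of `|𝓗(F)|` equals `1`, then `F` agrees a.e. on `[-1/2,1/2]` with the magic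
function `𝔉(x) = (2/π)·log((1 + √(1 − 4x²))/(2|x|))`. -/
theorem stmt5 (F : ℝ → ℝ) (hF : memAstar F) (hFint : ∫ x : ℝ, F x = 1)
    (G : ℝ → ℝ) (hG : ∀ᵐ x ∂(volume : Measure ℝ), pvHilbAt F x (G x))
    (hGnorm : eLpNorm G ⊤ volume = 1) :
    ∀ᵐ x ∂(volume : Measure ℝ), x ∈ Set.Icc (-(1/2) : ℝ) (1/2) →
      F x = (2 / Real.pi) * Real.log ((1 + Real.sqrt (1 - 4 * x ^ 2)) / (2 * |x|)) := by
  obtain ⟨hi, hpos, h0⟩ := hF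
  have hpi := Real.pi_pos
  have hG1 : ∀ᵐ x : ℝ, |G x| ≤ 1 := by
    rw [eLpNorm_exponent_top] at hGnorm
    filter_upwards [enorm_ae_le_eLpNormEssSup G volume] with x hx
    rw [hGnorm, ← ofReal_norm, Real.norm_eq_abs] at hx
    exact ENNReal.ofReal_le_one.1 hx
  have hlim : ∀ᵐ x : ℝ, Tendsto (fun η : ℝ => cau F (x + η * Complex.I))
      (nhdsWithin 0 (Set.Ioi 0))
      (nhds ((Real.pi * G x : ℝ) - (Real.pi * F x : ℝ) * Complex.I)) := by
    filter_upwards [bdry F hi, hG] with x h1 h2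
    exact h1 _ h2
  have hC : ∀ z : ℂ, 0 < z.im → |(cau F z).re| ≤ Real.pi := by
    refine fun z hz => uhp_bound (cau F) (cau_diff F hi) (cau_im F hi hpos) ?_ (cau_inf F hi) z hz
    filter_upwards [hlim, hG1] with x h1 h2
    refine ⟨Real.pi * G x, ?_, ?_⟩
    · rw [abs_mul, abs_of_pos hpi]; nlinarith
    · have := (Complex.continuous_re.tendsto _).comp h1
      have h3 : ((Real.pi * G x : ℝ) - (Real.pi * F x : ℝ) * Complex.I : ℂ).re = Real.pi * G x := by
        simp
      rw [h3] at this
      exact this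
  have hnull : ∀ a : ℝ, ∀ᵐ x : ℝ, x ≠ a := fun a => by
    rw [ae_iff]; simp
  filter_upwards [hlim, hpos, hnull 0, hnull (1/2), hnull (-(1/2))] with x hl hp hx0 hx1 hx2 hx
  refine final_alg x (F x) (G x) hx0 ?_ hp ?_
  · rw [abs_lt]
    exact ⟨lt_of_le_of_ne hx.1 (Ne.symm hx2), lt_of_le_of_ne hx.2 hx1⟩
  · have hz : Tendsto (fun η : ℝ => (x:ℂ) + η * Complex.I) (nhdsWithin 0 (Set.Ioi 0)) (nhds (x:ℂ)) := by
      have : Continuous fun η : ℝ => (x:ℂ) + η * Complex.I := by fun_prop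
      have := this.tendsto 0
      simp only [Complex.ofReal_zero, zero_mul, add_zero] at this
      exact this.mono_left nhdsWithin_le_nhds
    have h1 := (hz.const_mul 2).mul
      ((Complex.continuous_sin.tendsto _).comp (hl.div_const 2))
    refine tendsto_nhds_unique (h1.congr' ?_) (tendsto_const_nhds (x := (1:ℂ)))
    filter_upwards [self_mem_nhdsWithin] with η hη
    have hη : 0 < η := hη
    exact sin_cau F hi h0 hFint hC _ (by simpa using hη)
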